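/- Let Θ = (Θ_1,…,Θ_n) be uniformly distributed on the unit sphere S^{n−1}, let δ_1^4,…,δ_n^4 be positive reals with δ_j^4 ≥ k² ≥ 1, set δ^4 = (1/n)Σ_{j=1}^n δ_j^4, and let β_1,…,β_n be real coefficients with β_j² ≤ 2^6·δ_j^4 for each j. Then there exist absolute constants C₃, c₃ > 0 such that for every t > 0, P(|Σ_{j=1}^n β_j Θ_j³| ≥ t·δ^4/n) ≤ C₃·exp(−c₃·t^{2/3}). -/

import Mathlib

open MeasureTheory ProbabilityTheory Real
open scoped ENNReal BigOperators

/-- The normalized uniform (Lebesgue) measure on the unit sphere `S^{n-1} ⊆ ℝ^n`. -/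
noncomputable def uniformSphere (n : ℕ) :
    Measure (Metric.sphere (0 : EuclideanSpace ℝ (Fin n)) 1) :=
  (((volume : Measure (EuclideanSpace ℝ (Fin n))).toSphere Set.univ)⁻¹ •
    (volume : Measure (EuclideanSpace ℝ (Fin n))).toSphere)

section Polar

variable {E : Type*} [NormedAddCommGroup E] [NormedSpace ℝ E] [FiniteDimensional ℝ E]
  [MeasurableSpace E] [BorelSpace E]

/-- Polar coordinates for a positively homogeneous function with a radial weight. -/
lemma integral_homogeneous_mul_radial [Nontrivial E] (μ : Measure E) [μ.IsAddHaarMeasure]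
    (F : E → ℝ) (g : ℝ → ℝ) (d : ℕ)
    (hF : ∀ (r : ℝ) (x : E), 0 < r → F (r • x) = r ^ d * F x) :
    ∫ x, F x * g ‖x‖ ∂μ =
      (∫ θ : Metric.sphere (0 : E) 1, F θ ∂μ.toSphere) *
        ∫ r : Set.Ioi (0 : ℝ), (r : ℝ) ^ d * g r
          ∂Measure.volumeIoiPow (Module.finrank ℝ E - 1) := by
  have h0 : ∫ x, F x * g ‖x‖ ∂μ =
      ∫ x : ({0}ᶜ : Set E), F x * g ‖(x : E)‖ ∂μ.comap (↑) := by
    rw [integral_subtype_comap (measurableSet_singleton _).compl fun x ↦ F x * g ‖x‖,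
      MeasureTheory.restrict_compl_singleton]
  rw [h0, ← integral_prod_mul, ← μ.measurePreserving_homeomorphUnitSphereProd.integral_comp
    (Homeomorph.measurableEmbedding _)]
  refine integral_congr_ae (Filter.Eventually.of_forall fun x ↦ ?_)
  have hx : 0 < ‖(x : E)‖ := norm_pos_iff.2 x.2
  have h := hF ‖(x : E)‖ (‖(x : E)‖⁻¹ • (x : E)) hx
  rw [smul_inv_smul₀ hx.ne'] at h
  simp only [homeomorphUnitSphereProd_apply_snd_coe, homeomorphUnitSphereProd_apply_fst_coe]
  rw [h]
  ring

end Polar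

lemma isProbabilityMeasure_uniformSphere {n : ℕ} (hn : 0 < n) :
    IsProbabilityMeasure (uniformSphere n) := by
  have : Nonempty (Fin n) := ⟨⟨0, hn⟩⟩
  refine ⟨?_⟩
  rw [uniformSphere, Measure.smul_apply, smul_eq_mul]
  exact ENNReal.inv_mul_cancel (Measure.measure_univ_ne_zero.2 (Measure.toSphere_ne_zero _))
    (measure_ne_top _ _)

/-- The mean of a homogeneous function on the sphere, through its Gaussian mean. -/
lemma integral_uniformSphere_mul_gaussian {n : ℕ} (hn : 0 < n) (F : EuclideanSpace ℝ (Fin n) → ℝ)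
    (d : ℕ) (hF : ∀ (r : ℝ) (x : EuclideanSpace ℝ (Fin n)), 0 < r → F (r • x) = r ^ d * F x) :
    (∫ θ, F θ ∂uniformSphere n) * ∫ x : EuclideanSpace ℝ (Fin n), ‖x‖ ^ d * rexp (-‖x‖ ^ 2) =
      ∫ x, F x * rexp (-‖x‖ ^ 2) := by
  have : Nonempty (Fin n) := ⟨⟨0, hn⟩⟩
  rw [integral_homogeneous_mul_radial volume F (fun r ↦ rexp (-r ^ 2)) d hF,
    integral_homogeneous_mul_radial volume (fun x ↦ ‖x‖ ^ d) (fun r ↦ rexp (-r ^ 2)) d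
      (fun r x hr ↦ by rw [norm_smul, mul_pow, Real.norm_of_nonneg hr.le]),
    uniformSphere, integral_smul_measure]
  have h1 : ∫ θ : Metric.sphere (0 : EuclideanSpace ℝ (Fin n)) 1, ‖(θ : EuclideanSpace ℝ (Fin n))‖ ^ d
      ∂(volume : Measure (EuclideanSpace ℝ (Fin n))).toSphere =
      ((volume : Measure (EuclideanSpace ℝ (Fin n))).toSphere Set.univ).toReal := by
    simp [measureReal_def]
  have h2 : ((volume : Measure (EuclideanSpace ℝ (Fin n))).toSphere Set.univ).toReal ≠ 0 :=
    (ENNReal.toReal_pos (Measure.measure_univ_ne_zero.2 (Measure.toSphere_ne_zero _))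
      (measure_ne_top _ _)).ne'
  rw [h1, ENNReal.toReal_inv, smul_eq_mul]
  field_simp

lemma integral_prod_mul_gaussian {n : ℕ} (f : Fin n → ℝ → ℝ) :
    ∫ x : EuclideanSpace ℝ (Fin n), (∏ i, f i (x i)) * rexp (-‖x‖ ^ 2) =
      ∏ i, ∫ y, f i y * rexp (-y ^ 2) := by
  rw [← integral_fintype_prod_volume_eq_prod (fun i y ↦ f i y * rexp (-y ^ 2)),
    ← (PiLp.volume_preserving_toLp (Fin n)).integral_comp
      (MeasurableEquiv.toLp 2 _).measurableEmbedding]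
  refine integral_congr_ae (Filter.Eventually.of_forall fun x ↦ ?_)
  simp [EuclideanSpace.norm_sq_eq, Finset.prod_mul_distrib, ← Real.exp_sum]

lemma integrable_prod_mul_gaussian {n : ℕ} (f : Fin n → ℝ → ℝ)
    (hf : ∀ i, Integrable fun y ↦ f i y * rexp (-y ^ 2)) :
    Integrable fun x : EuclideanSpace ℝ (Fin n) ↦ (∏ i, f i (x i)) * rexp (-‖x‖ ^ 2) := by
  rw [← (PiLp.volume_preserving_toLp (Fin n)).integrable_comp_emb
    (MeasurableEquiv.toLp 2 _).measurableEmbedding]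
  refine (Integrable.fintype_prod hf).congr (Filter.Eventually.of_forall fun x ↦ ?_)
  simp [EuclideanSpace.norm_sq_eq, Finset.prod_mul_distrib, ← Real.exp_sum]

lemma integrable_pow_mul_gaussian (k : ℕ) : Integrable fun y : ℝ ↦ y ^ k * rexp (-y ^ 2) := by
  have := integrable_rpow_mul_exp_neg_mul_sq one_pos (s := k)
    (by linarith [Nat.cast_nonneg (α := ℝ) k])
  simpa using this

lemma integral_Ioi_pow_mul_gaussian (k : ℕ) :
    ∫ y in Set.Ioi (0 : ℝ), y ^ k * rexp (-y ^ 2) = 1 / 2 * Gamma ((k + 1) / 2) := by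
  have := integral_rpow_mul_exp_neg_rpow (p := 2) (q := k) two_pos
    (by linarith [Nat.cast_nonneg (α := ℝ) k])
  simpa using this

lemma integral_odd_pow_mul_gaussian {k : ℕ} (hk : Odd k) :
    ∫ y : ℝ, y ^ k * rexp (-y ^ 2) = 0 := by
  have h := integral_neg_eq_self (fun y : ℝ ↦ y ^ k * rexp (-y ^ 2)) volume
  simp only [hk.neg_pow, neg_sq, neg_mul, integral_neg] at h
  linarith

lemma integral_even_pow_mul_gaussian (m : ℕ) :
    ∫ y : ℝ, y ^ (2 * m) * rexp (-y ^ 2) = Gamma (m + 1 / 2) := by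
  have h := integral_comp_abs (f := fun y ↦ y ^ (2 * m) * rexp (-y ^ 2))
  simp only [(even_two_mul m).pow_abs, sq_abs, integral_Ioi_pow_mul_gaussian] at h
  rw [h]
  push_cast
  rw [← mul_assoc]
  norm_num
  congr 1
  ring

lemma Gamma_nat_add_half_le (m : ℕ) : Gamma (m + 1 / 2) ≤ m.factorial * √π := by
  induction m with
  | zero => simp [-one_div, Gamma_one_half_eq]
  | succ m ih =>
    rw [Nat.cast_succ, add_right_comm, Gamma_add_one (by positivity), Nat.factorial_succ]
    push_cast
    rw [mul_assoc]
    gcongr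
    norm_num

lemma pow_mul_Gamma_le (a : ℝ) (ha : 0 < a) (m : ℕ) : a ^ m * Gamma a ≤ Gamma (a + m) := by
  induction m with
  | zero => simp
  | succ m ih =>
    rw [Nat.cast_succ, ← add_assoc, Gamma_add_one (by positivity), pow_succ', mul_assoc]
    have := (Gamma_pos_of_pos ha).le
    gcongr
    simp

lemma integral_gaussian_eq (n : ℕ) :
    ∫ x : EuclideanSpace ℝ (Fin n), rexp (-‖x‖ ^ 2) = √π ^ n := by
  have h := integral_prod_mul_gaussian (n := n) (fun _ _ ↦ 1)
  have h' := integral_even_pow_mul_gaussian 0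
  simp only [mul_zero, pow_zero, one_mul, Nat.cast_zero, zero_add, Gamma_one_half_eq] at h'
  simpa [h'] using h

/-- A lower bound on the even moments of the norm of a Gaussian vector. -/
lemma le_integral_norm_pow_mul_gaussian {n : ℕ} (hn : 0 < n) (m : ℕ) :
    ((n : ℝ) / 2) ^ m * √π ^ n ≤
      ∫ x : EuclideanSpace ℝ (Fin n), ‖x‖ ^ (2 * m) * rexp (-‖x‖ ^ 2) := by
  have : Nonempty (Fin n) := ⟨⟨0, hn⟩⟩
  have key (j : ℕ) : ∫ x : EuclideanSpace ℝ (Fin n), ‖x‖ ^ (2 * j) * rexp (-‖x‖ ^ 2) =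
      n * (volume : Measure (EuclideanSpace ℝ (Fin n))).real (Metric.ball 0 1) *
        (1 / 2 * Gamma (n / 2 + j)) := by
    rw [integral_fun_norm_addHaar volume (fun r ↦ r ^ (2 * j) * rexp (-r ^ 2))]
    simp only [finrank_euclideanSpace, Fintype.card_fin, smul_eq_mul, nsmul_eq_mul,
      ← mul_assoc, ← pow_add]
    rw [integral_Ioi_pow_mul_gaussian]
    push_cast [Nat.cast_pred hn]
    ring_nf
  have h0 := key 0
  simp only [mul_zero, pow_zero, one_mul, integral_gaussian_eq, Nat.cast_zero, add_zero] at h0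
  rw [h0, key m]
  have := pow_mul_Gamma_le ((n : ℝ) / 2) (by positivity) m
  calc _ = n * (volume : Measure (EuclideanSpace ℝ (Fin n))).real (Metric.ball 0 1) *
        (1 / 2 * (((n : ℝ) / 2) ^ m * Gamma (n / 2))) := by ring
    _ ≤ _ := by gcongr

lemma factorial_three_mul_le (m : ℕ) :
    (3 * m).factorial ≤ 8 ^ m * ((2 * m).factorial * m.factorial) := by
  rw [show 3 * m = 2 * m + m by ring, ← Nat.add_choose_mul_factorial_mul_factorial, mul_assoc]
  gcongr
  calc (2 * m + m).choose m ≤ 2 ^ (2 * m + m) := Nat.choose_le_two_pow _ _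
    _ = 8 ^ m := by rw [show 2 * m + m = 3 * m by ring, pow_mul]; norm_num

lemma sum_piAntidiag_two_mul_of_odd_eq_zero {ι : Type*} [Fintype ι] [DecidableEq ι]
    (q : ι → ℕ → ℝ) (hq : ∀ i k, Odd k → q i k = 0) (p : ℕ) :
    ∑ k ∈ Finset.piAntidiag Finset.univ (2 * p), ∏ i, q i (k i) =
      ∑ m ∈ Finset.piAntidiag Finset.univ p, ∏ i, q i (2 * m i) := by
  have h := Finset.map_nsmul_piAntidiag_univ (ι := ι) p two_ne_zero
  rw [← Finset.sum_filter_of_ne (p := fun k : ι → ℕ ↦ ∀ i, 2 ∣ k i), ← h, Finset.sum_map]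
  · simp
  · intro k _ hk i
    by_contra hi
    exact hk (Finset.prod_eq_zero (Finset.mem_univ i)
      (hq i _ (Nat.not_even_iff_odd.1 fun h ↦ hi h.two_dvd)))

lemma sum_piAntidiag_prod_factorial_mul_pow_le {ι : Type*} [Fintype ι] [DecidableEq ι]
    (a : ι → ℝ) (ha : ∀ i, 0 ≤ a i) (p : ℕ) :
    ∑ m ∈ Finset.piAntidiag Finset.univ p, ∏ i, ((m i).factorial * a i ^ m i) ≤
      p.factorial * (∑ i, a i) ^ p := by
  rw [Finset.sum_pow_eq_sum_piAntidiag, Finset.mul_sum]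
  refine Finset.sum_le_sum fun m hm ↦ ?_
  have hm' : ∑ i, m i = p := (Finset.mem_piAntidiag.1 hm).1
  have h1 : ∏ i, ((m i).factorial : ℝ) ≤ p.factorial := by
    rw [← hm']
    exact_mod_cast Nat.le_of_dvd (Nat.factorial_pos _)
      (Nat.prod_factorial_dvd_factorial_sum Finset.univ m)
  have h2 : (1 : ℝ) ≤ Nat.multinomial Finset.univ m := by
    exact_mod_cast Nat.multinomial_pos Finset.univ m
  have h3 : 0 ≤ ∏ i, a i ^ m i := Finset.prod_nonneg fun i _ ↦ pow_nonneg (ha i) _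
  rw [Finset.prod_mul_distrib]
  gcongr
  exact le_mul_of_one_le_left h3 h2

lemma integral_cubic_pow_mul_gaussian_nonneg (b : ℝ) (m : ℕ) :
    0 ≤ ∫ y : ℝ, (b * y ^ 3) ^ (2 * m) * rexp (-y ^ 2) :=
  integral_nonneg fun _ ↦ mul_nonneg ((even_two_mul m).pow_nonneg _) (Real.exp_pos _).le

lemma integral_cubic_pow_mul_gaussian_odd (b : ℝ) {k : ℕ} (hk : Odd k) :
    ∫ y : ℝ, (b * y ^ 3) ^ k * rexp (-y ^ 2) = 0 := by
  simp only [mul_pow, ← pow_mul, mul_assoc]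
  rw [integral_const_mul, integral_odd_pow_mul_gaussian (Odd.mul (by decide) hk), mul_zero]

lemma integral_cubic_pow_mul_gaussian_le (b : ℝ) (m : ℕ) :
    ((2 * m).factorial : ℝ)⁻¹ * ∫ y : ℝ, (b * y ^ 3) ^ (2 * m) * rexp (-y ^ 2) ≤
      √π * (m.factorial * (8 * b ^ 2) ^ m) := by
  simp only [mul_pow, ← pow_mul, mul_assoc]
  rw [integral_const_mul, show 3 * (2 * m) = 2 * (3 * m) by ring, integral_even_pow_mul_gaussian,
    inv_mul_le_iff₀ (by positivity)]
  have h : ((3 * m).factorial : ℝ) ≤ 8 ^ m * ((2 * m).factorial * m.factorial) := by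
    exact_mod_cast factorial_three_mul_le m
  have hb : 0 ≤ b ^ (2 * m) := (even_two_mul m).pow_nonneg _
  calc b ^ (2 * m) * Gamma ((3 * m : ℕ) + 1 / 2)
      ≤ b ^ (2 * m) * ((3 * m).factorial * √π) := by gcongr; exact Gamma_nat_add_half_le _
    _ ≤ b ^ (2 * m) * (8 ^ m * ((2 * m).factorial * m.factorial) * √π) := by gcongr
    _ = _ := by ring

/-- Even moments of a cubic sum of Gaussian coordinates. -/
lemma integral_cubic_sum_pow_mul_gaussian_le {n : ℕ} (β : Fin n → ℝ) (p : ℕ) :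
    ∫ x : EuclideanSpace ℝ (Fin n), (∑ j, β j * x j ^ 3) ^ (2 * p) * rexp (-‖x‖ ^ 2) ≤
      (2 * p).factorial * (p.factorial * (8 * ∑ j, β j ^ 2) ^ p) * √π ^ n := by
  set q : Fin n → ℕ → ℝ := fun i k ↦
    (k.factorial : ℝ)⁻¹ * ∫ y : ℝ, (β i * y ^ 3) ^ k * rexp (-y ^ 2) with hq
  have h1 : ∫ x : EuclideanSpace ℝ (Fin n), (∑ j, β j * x j ^ 3) ^ (2 * p) * rexp (-‖x‖ ^ 2) =
      (2 * p).factorial * ∑ k ∈ Finset.piAntidiag Finset.univ (2 * p), ∏ i, q i (k i) := by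
    simp only [Finset.sum_pow_eq_sum_piAntidiag, Finset.sum_mul, mul_assoc]
    rw [integral_finsetSum, Finset.mul_sum]
    · refine Finset.sum_congr rfl fun k hk ↦ ?_
      rw [integral_const_mul, integral_prod_mul_gaussian fun i y ↦ (β i * y ^ 3) ^ k i, hq,
        Finset.prod_mul_distrib, ← mul_assoc]
      congr 1
      have hs := Nat.multinomial_spec Finset.univ k
      rw [(Finset.mem_piAntidiag.1 hk).1] at hs
      rw [← hs, Finset.prod_inv_distrib]
      push_cast
      have : (∏ i, ((k i).factorial : ℝ)) ≠ 0 := Finset.prod_ne_zero_iff.2 fun i _ ↦ by positivity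
      field_simp
    · intro k _
      refine (integrable_prod_mul_gaussian (fun i y ↦ (β i * y ^ 3) ^ k i) fun i ↦ ?_).const_mul _
      simp only [mul_pow, ← pow_mul, mul_assoc]
      exact (integrable_pow_mul_gaussian _).const_mul _
  rw [h1, mul_assoc, sum_piAntidiag_two_mul_of_odd_eq_zero q fun i k hk ↦ by
    simp [hq, integral_cubic_pow_mul_gaussian_odd _ hk]]
  gcongr
  calc ∑ m ∈ Finset.piAntidiag Finset.univ p, ∏ i, q i (2 * m i)
      ≤ ∑ m ∈ Finset.piAntidiag Finset.univ p,
          ∏ i, (√π * ((m i).factorial * (8 * β i ^ 2) ^ m i)) := by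
        refine Finset.sum_le_sum fun m _ ↦ Finset.prod_le_prod (fun i _ ↦ ?_) fun i _ ↦
          integral_cubic_pow_mul_gaussian_le _ _
        exact mul_nonneg (by positivity) (integral_cubic_pow_mul_gaussian_nonneg _ _)
    _ = (∑ m ∈ Finset.piAntidiag Finset.univ p,
          ∏ i, ((m i).factorial * (8 * β i ^ 2) ^ m i)) * √π ^ n := by
        rw [Finset.sum_mul]
        refine Finset.sum_congr rfl fun m _ ↦ ?_
        rw [Finset.prod_mul_distrib, Finset.prod_const, Finset.card_fin, mul_comm]
    _ ≤ _ := by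
        rw [Finset.mul_sum]
        gcongr
        exact sum_piAntidiag_prod_factorial_mul_pow_le _ (fun i ↦ by positivity) p

/-- Even moments of a cubic sum on the sphere. -/
lemma integral_uniformSphere_cubic_sum_pow_le {n : ℕ} (hn : 0 < n) (β : Fin n → ℝ) (p : ℕ) :
    ∫ θ, (∑ j, β j * (θ.1 j) ^ 3) ^ (2 * p) ∂uniformSphere n ≤
      (64 * p ^ 3 * (4 * ∑ j, β j ^ 2) / (n : ℝ) ^ 3) ^ p := by
  have hn' : (0 : ℝ) < n := by exact_mod_cast hn
  have hpi : 0 < √π ^ n := by positivity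
  have h1 := integral_uniformSphere_mul_gaussian hn
    (fun x ↦ (∑ j, β j * x j ^ 3) ^ (2 * p)) (2 * (3 * p)) (fun r x _ ↦ by
      simp only [PiLp.smul_apply, smul_eq_mul, mul_pow, mul_left_comm _ (r ^ 3), ← Finset.mul_sum]
      rw [← pow_mul]
      ring_nf)
  have h2 := integral_cubic_sum_pow_mul_gaussian_le β p
  have h3 := le_integral_norm_pow_mul_gaussian hn (3 * p)
  set I := ∫ θ, (∑ j, β j * (θ.1 j) ^ 3) ^ (2 * p) ∂uniformSphere n with hI
  have hI0 : 0 ≤ I := integral_nonneg fun θ ↦ (even_two_mul p).pow_nonneg _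
  have h4 : I * ((n / 2 : ℝ) ^ (3 * p) * √π ^ n) ≤
      (2 * p).factorial * (p.factorial * (8 * ∑ j, β j ^ 2) ^ p) * √π ^ n :=
    (mul_le_mul_of_nonneg_left h3 hI0).trans (h1.le.trans h2)
  rw [← mul_assoc] at h4
  have h5 := le_of_mul_le_mul_right h4 hpi
  have hs : 0 ≤ ∑ j, β j ^ 2 := Finset.sum_nonneg fun j _ ↦ sq_nonneg _
  have hf1 : ((2 * p).factorial : ℝ) ≤ (2 * p) ^ (2 * p) := by
    exact_mod_cast Nat.factorial_le_pow (2 * p)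
  have hf2 : (p.factorial : ℝ) ≤ p ^ p := by exact_mod_cast Nat.factorial_le_pow p
  rw [← le_div_iff₀ (by positivity)] at h5
  calc I ≤ (2 * p : ℝ) ^ (2 * p) * (p ^ p * (8 * ∑ j, β j ^ 2) ^ p) / (n / 2 : ℝ) ^ (3 * p) := by
        refine h5.trans ?_
        gcongr
    _ = _ := by
        rw [pow_mul, pow_mul, ← mul_pow, ← mul_pow, ← div_pow]
        congr 1
        field_simp
        ring

lemma uniformSphere_cubic_sum_tail_le {n : ℕ} (hn : 0 < n) (β : Fin n → ℝ) (p : ℕ) {a : ℝ}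
    (ha : 0 < a) :
    (uniformSphere n).real {θ | a ≤ |∑ j, β j * (θ.1 j) ^ 3|} ≤
      (256 * p ^ 3 * (∑ j, β j ^ 2) / ((n : ℝ) ^ 3 * a ^ 2)) ^ p := by
  have := isProbabilityMeasure_uniformSphere hn
  have hn' : (0 : ℝ) < n := by exact_mod_cast hn
  have hcont : Continuous fun θ : Metric.sphere (0 : EuclideanSpace ℝ (Fin n)) 1 ↦
      (∑ j, β j * (θ.1 j) ^ 3) ^ (2 * p) := by fun_prop
  have hmarkov := mul_meas_ge_le_integral_of_nonneg (μ := uniformSphere n)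
    (Filter.Eventually.of_forall fun θ ↦ (even_two_mul p).pow_nonneg _)
    (hcont.integrable_of_hasCompactSupport (HasCompactSupport.of_compactSpace _)) (a ^ (2 * p))
  have hsub : (uniformSphere n).real {θ | a ≤ |∑ j, β j * (θ.1 j) ^ 3|} ≤
      (uniformSphere n).real {θ | a ^ (2 * p) ≤ (∑ j, β j * (θ.1 j) ^ 3) ^ (2 * p)} := by
    refine measureReal_mono fun θ hθ ↦ ?_
    rw [Set.mem_ofPred_eq, ← (even_two_mul p).pow_abs (∑ j, β j * (θ.1 j) ^ 3)]
    exact pow_le_pow_left₀ ha.le hθ _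
  have h := hmarkov.trans (integral_uniformSphere_cubic_sum_pow_le hn β p)
  rw [← le_div_iff₀' (by positivity)] at h
  refine (hsub.trans h).trans_eq ?_
  rw [pow_mul, ← div_pow]
  congr 1
  field_simp
  ring


/-- concentration of the cubic sum `Σ β_j Θ_j³` for a uniform
direction `Θ` on the sphere. -/
theorem cubic_sum_sphere_concentration :
    ∃ C₃ c₃ : ℝ, 0 < C₃ ∧ 0 < c₃ ∧
      ∀ (n k : ℕ), 0 < n → 1 ≤ k →
      ∀ (δ4 : Fin n → ℝ), (∀ j, (k : ℝ) ^ 2 ≤ δ4 j) →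
      ∀ (β : Fin n → ℝ), (∀ j, β j ^ 2 ≤ 2 ^ 6 * δ4 j) →
      ∀ t : ℝ, 0 < t →
        uniformSphere n {θ : Metric.sphere (0 : EuclideanSpace ℝ (Fin n)) 1 |
            t * (((∑ j, δ4 j) / n) / n) ≤ |∑ j, β j * (θ.1 j) ^ 3|} ≤
          ENNReal.ofReal (C₃ * Real.exp (-c₃ * t ^ ((2 : ℝ) / 3))) := by
  refine ⟨rexp 1, 1 / 64, Real.exp_pos _, by norm_num, ?_⟩
  intro n k hn hk δ4 hδ β hβ t ht
  have := isProbabilityMeasure_uniformSphere hn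
  have hn' : (0 : ℝ) < n := by exact_mod_cast hn
  have hk' : (1 : ℝ) ≤ k := by exact_mod_cast hk
  set D := (∑ j, δ4 j) / n with hD
  have hsum : ∑ j, δ4 j = n * D := by rw [hD]; field_simp
  have hD1 : 1 ≤ D := by
    rw [hD, le_div_iff₀ hn']
    calc 1 * (n : ℝ) = ∑ _j : Fin n, (1 : ℝ) := by simp
      _ ≤ _ := Finset.sum_le_sum fun j _ ↦ (one_le_pow₀ hk').trans (hδ j)
  have hβsum : ∑ j, β j ^ 2 ≤ 64 * (n * D) := by
    rw [← hsum, Finset.mul_sum]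
    exact Finset.sum_le_sum fun j _ ↦ (hβ j).trans_eq (by norm_num)
  set s := t ^ ((2 : ℝ) / 3) with hs
  have hs0 : 0 < s := Real.rpow_pos_of_pos ht _
  have hs3 : s ^ 3 = t ^ 2 := by
    rw [hs, ← Real.rpow_natCast, ← Real.rpow_mul ht.le, ← Real.rpow_natCast t 2]
    norm_num
  set p := ⌊s / 64⌋₊ with hp
  have hp1 : (p : ℝ) ≤ s / 64 := Nat.floor_le (by positivity)
  have hp2 : s / 64 < p + 1 := Nat.lt_floor_add_one _
  have hp3 : 64 ^ 3 * (p : ℝ) ^ 3 ≤ t ^ 2 := by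
    rw [← hs3, ← mul_pow]
    gcongr
    linarith
  have hbase : 256 * (p : ℝ) ^ 3 * (∑ j, β j ^ 2) / ((n : ℝ) ^ 3 * (t * (D / n)) ^ 2) ≤
      rexp (-1) := by
    have h16 : (1 : ℝ) / 16 ≤ rexp (-1) := by
      rw [Real.exp_neg, one_div]
      gcongr
      linarith [Real.exp_one_lt_d9]
    refine le_trans ?_ h16
    rw [div_le_iff₀ (by positivity)]
    calc 256 * (p : ℝ) ^ 3 * (∑ j, β j ^ 2) ≤ 256 * (p : ℝ) ^ 3 * (64 * (n * D)) := by gcongr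
      _ = 1 / 16 * n * (64 ^ 3 * (p : ℝ) ^ 3) * (D * 1) := by ring
      _ ≤ 1 / 16 * n * t ^ 2 * (D * D) := by gcongr
      _ = _ := by field_simp
  have htail := uniformSphere_cubic_sum_tail_le hn β p (a := t * (D / n)) (by positivity)
  rw [← ofReal_measureReal]
  refine ENNReal.ofReal_le_ofReal (htail.trans ?_)
  have hS : 0 ≤ ∑ j, β j ^ 2 := Finset.sum_nonneg fun j _ ↦ sq_nonneg _
  calc _ ≤ rexp (-1) ^ p := pow_le_pow_left₀ (by positivity) hbase _
    _ = rexp (-p) := by rw [← Real.exp_nat_mul]; simp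
    _ ≤ rexp (1 + -(1 / 64) * s) := by
        gcongr
        linarith
    _ = _ := Real.exp_add _ _
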